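/- Let A = [[B, C], [Cᵀ, D]] be a 2n×2n real symmetric positive definite matrix, M = (B + D - i(C - Cᵀ))/2, N = (B - D + i(C + Cᵀ))/2, and S = M - N·conj(M)⁻¹·conj(N). Then S is Hermitian positive definite and its eigenvalues interlace those of A: λ_k(A) ≤ λ_k(S) ≤ λ_{k+n}(A) for k = 1, …, n (eigenvalues in increasing order). -/

import Mathlib

open Matrix ComplexOrder

/-- Eigenvalues of a Hermitian matrix listed in increasing order. -/
noncomputable def sortedEigs {m : ℕ} {𝕜 : Type*} [RCLike 𝕜] {A : Matrix (Fin m) (Fin m) 𝕜}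
    (hA : A.IsHermitian) : Fin m → ℝ :=
  hA.eigenvalues ∘ Tuple.sort hA.eigenvalues

/-- A linear system with more free unknowns (`s`) than equations (`t`) has a nonzero solution. -/
lemma exists_ne_zero_mulVec_eq_zero_on {ι κ : Type*} [Fintype ι] [DecidableEq ι]
    (L : Matrix κ ι ℂ) (s : Finset ι) (t : Finset κ) (hcard : t.card < s.card) :
    ∃ x : ι → ℂ, x ≠ 0 ∧ (∀ i, i ∉ s → x i = 0) ∧ ∀ j ∈ t, (L *ᵥ x) j = 0 := by
  let E : (s → ℂ) →ₗ[ℂ] (ι → ℂ) := Function.ExtendByZero.linearMap ℂ (Subtype.val : s → ι)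
  let R : (s → ℂ) →ₗ[ℂ] (t → ℂ) := LinearMap.funLeft ℂ ℂ (Subtype.val : t → κ) ∘ₗ L.mulVecLin ∘ₗ E
  have hker : LinearMap.ker R ≠ ⊥ := LinearMap.ker_ne_bot_of_finrank_lt (by simpa using hcard)
  obtain ⟨y, hy, hy0⟩ := (Submodule.ne_bot_iff _).1 hker
  refine ⟨E y, fun h => hy0 ?_, fun i hi => ?_, fun j hj => ?_⟩
  · ext i
    have := congrFun h i
    simpa [E, Subtype.val_injective.extend_apply] using this
  · have : ¬ ∃ a : s, a.1 = i := by rintro ⟨a, rfl⟩; exact hi a.2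
    simp [E, Function.extend_apply' _ _ _ this]
  · exact congrFun (LinearMap.mem_ker.1 hy) ⟨j, hj⟩

lemma re_star_dotProduct_self {ι : Type*} [Fintype ι] (x : ι → ℂ) :
    (star x ⬝ᵥ x).re = ∑ i, Complex.normSq (x i) := by
  simp [dotProduct, Complex.normSq_apply]

lemma star_mulVec_dotProduct {ι κ κ' : Type*} [Fintype ι] [Fintype κ] [Fintype κ']
    (F : Matrix ι κ ℂ) (E : Matrix ι κ' ℂ) (x : κ → ℂ) (y : κ' → ℂ) :
    star (F *ᵥ x) ⬝ᵥ (E *ᵥ y) = star x ⬝ᵥ ((Fᴴ * E) *ᵥ y) := by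
  rw [star_mulVec, ← dotProduct_mulVec, mulVec_mulVec]

lemma sum_normSq_conjTranspose_mulVec {ι κ : Type*} [Fintype ι] [Fintype κ] [DecidableEq ι]
    {P : Matrix ι κ ℂ} (hP : P * Pᴴ = 1) (w : ι → ℂ) :
    ∑ j, Complex.normSq ((Pᴴ *ᵥ w) j) = ∑ i, Complex.normSq (w i) := by
  rw [← re_star_dotProduct_self, ← re_star_dotProduct_self, star_mulVec_dotProduct,
    conjTranspose_conjTranspose, hP, one_mulVec]

lemma re_form_eq_sum {ι κ : Type*} [Fintype ι] [Fintype κ] [DecidableEq κ]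
    {G : Matrix ι ι ℂ} {P : Matrix ι κ ℂ} {g : κ → ℝ}
    (hG : G = P * diagonal (fun j => (g j : ℂ)) * Pᴴ) (w : ι → ℂ) :
    (star w ⬝ᵥ G *ᵥ w).re = ∑ j, g j * Complex.normSq ((Pᴴ *ᵥ w) j) := by
  have h : star w ⬝ᵥ G *ᵥ w = star (Pᴴ *ᵥ w) ⬝ᵥ (diagonal (fun j => (g j : ℂ)) *ᵥ (Pᴴ *ᵥ w)) := by
    rw [mulVec_mulVec, star_mulVec_dotProduct, conjTranspose_conjTranspose, hG, Matrix.mul_assoc]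
  rw [h]
  simp only [dotProduct, mulVec_diagonal, Complex.re_sum]
  refine Finset.sum_congr rfl fun j _ => ?_
  simp [Complex.normSq_apply]
  ring

/-- The dimension-count comparison underlying the Courant-Fischer inequalities. -/
lemma le_of_diagonal_forms {ι κ μ : Type*} [Fintype ι] [Fintype κ] [Fintype μ]
    [DecidableEq ι] [DecidableEq κ] [DecidableEq μ]
    {P : Matrix μ κ ℂ} {Q : Matrix ι ι ℂ} (hP : P * Pᴴ = 1) (hQ : Qᴴ * Q = 1)
    (F : Matrix μ ι ℂ) (g : κ → ℝ) (h : ι → ℝ) (s : Finset ι) (t : Finset κ)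
    (hcard : t.card < s.card) {a b : ℝ} (hs : ∀ i ∈ s, h i ≤ a) (ht : ∀ j, j ∉ t → b ≤ g j)
    (hform : ∀ z, ∑ j, g j * Complex.normSq ((Pᴴ *ᵥ (F *ᵥ z)) j) ≤
      2 * ∑ i, h i * Complex.normSq ((Qᴴ *ᵥ z) i))
    (hnorm : ∀ z, b * (2 * ∑ i, Complex.normSq (z i)) ≤
      b * ∑ j, Complex.normSq ((F *ᵥ z) j)) :
    b ≤ a := by
  obtain ⟨x, hx0, hxs, hxt⟩ := exists_ne_zero_mulVec_eq_zero_on (Pᴴ * F * Q) s t hcard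
  have hQ' : Q * Qᴴ = 1 := mul_eq_one_comm.1 hQ
  have hQx : Qᴴ *ᵥ (Q *ᵥ x) = x := by rw [mulVec_mulVec, hQ, one_mulVec]
  have h1 := hform (Q *ᵥ x)
  have h2 := hnorm (Q *ᵥ x)
  have h3 := sum_normSq_conjTranspose_mulVec hQ' (Q *ᵥ x)
  have h4 := sum_normSq_conjTranspose_mulVec hP (F *ᵥ (Q *ᵥ x))
  rw [hQx] at h1 h3
  have hPFQ : Pᴴ *ᵥ (F *ᵥ (Q *ᵥ x)) = (Pᴴ * F * Q) *ᵥ x := by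
    simp [mulVec_mulVec, Matrix.mul_assoc]
  have h5 : ∑ i, h i * Complex.normSq (x i) ≤ a * ∑ i, Complex.normSq (x i) := by
    rw [Finset.mul_sum]
    refine Finset.sum_le_sum fun i _ => ?_
    by_cases hi : i ∈ s
    · exact mul_le_mul_of_nonneg_right (hs i hi) (Complex.normSq_nonneg _)
    · simp [hxs i hi]
  have h6 : b * ∑ j, Complex.normSq ((Pᴴ *ᵥ (F *ᵥ (Q *ᵥ x))) j) ≤
      ∑ j, g j * Complex.normSq ((Pᴴ *ᵥ (F *ᵥ (Q *ᵥ x))) j) := by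
    rw [Finset.mul_sum]
    refine Finset.sum_le_sum fun j _ => ?_
    by_cases hj : j ∈ t
    · rw [hPFQ, hxt j hj]; simp
    · exact mul_le_mul_of_nonneg_right (ht j hj) (Complex.normSq_nonneg _)
  have hpos : 0 < ∑ i, Complex.normSq (x i) := by
    obtain ⟨i, hi⟩ := Function.ne_iff.1 hx0
    exact Finset.sum_pos' (fun i _ => Complex.normSq_nonneg _)
      ⟨i, Finset.mem_univ _, Complex.normSq_pos.2 hi⟩
  rw [← h3] at h2
  rw [h4] at h6
  nlinarith

lemma sortedEigs_mono {m : ℕ} {𝕜 : Type*} [RCLike 𝕜] {A : Matrix (Fin m) (Fin m) 𝕜}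
    (hA : A.IsHermitian) : Monotone (sortedEigs hA) :=
  Tuple.monotone_sort _

/-- A unitary diagonalization with the eigenvalues in increasing order. -/
lemma exists_sorted_diagonalization {m : ℕ} {𝕜 : Type*} [RCLike 𝕜] {A : Matrix (Fin m) (Fin m) 𝕜}
    (hA : A.IsHermitian) : ∃ P : Matrix (Fin m) (Fin m) 𝕜, P * Pᴴ = 1 ∧ Pᴴ * P = 1 ∧
      A = P * diagonal (fun i => (sortedEigs hA i : 𝕜)) * Pᴴ := by
  let σ := Tuple.sort hA.eigenvalues
  let U : Matrix (Fin m) (Fin m) 𝕜 := hA.eigenvectorUnitary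
  have hU : U * Uᴴ = 1 := by
    have := Unitary.mul_star_self_of_mem hA.eigenvectorUnitary.2
    simpa [star_eq_conjTranspose] using this
  have h1 : U.submatrix id σ * (U.submatrix id σ)ᴴ = 1 := by
    rw [conjTranspose_submatrix, submatrix_mul_equiv, hU, submatrix_id_id]
  refine ⟨U.submatrix id σ, h1, mul_eq_one_comm.1 h1, ?_⟩
  have hd : diagonal (fun i => (sortedEigs hA i : 𝕜)) =
      (diagonal (fun i => (hA.eigenvalues i : 𝕜))).submatrix σ σ := by
    rw [submatrix_diagonal_equiv]; rfl
  rw [hd, submatrix_mul_equiv, conjTranspose_submatrix, submatrix_mul_equiv, submatrix_id_id]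
  have := hA.spectral_theorem
  rw [Unitary.conjStarAlgAut_apply] at this
  simpa [star_eq_conjTranspose, Function.comp_def] using this

/-- Congruence of a `2 × 2` block matrix by a block column. -/
lemma conjTranspose_fromRows_mul_fromBlocks_mul {ι κ : Type*} [Fintype ι]
    (B C C' D : Matrix ι ι ℂ) (X Y : Matrix ι κ ℂ) :
    (fromRows X Y)ᴴ * fromBlocks B C C' D * fromRows X Y =
      Xᴴ * B * X + Xᴴ * C * Y + Yᴴ * C' * X + Yᴴ * D * Y := by
  rw [conjTranspose_fromRows_eq_fromCols_conjTranspose, fromCols_mul_fromBlocks,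
    fromCols_mul_fromRows]
  simp only [Matrix.add_mul]
  abel

/-- Congruence by the columns `(1 + Y, -i (1 - Y))` turns a block matrix into the
quadratic expression given by its complex blocks. -/
lemma congruence_one_add_one_sub {n : ℕ} (B C C' D M N M' N' Y : Matrix (Fin n) (Fin n) ℂ)
    (hM : M = (2 : ℂ)⁻¹ • (B + D - Complex.I • (C - C')))
    (hN : N = (2 : ℂ)⁻¹ • (B - D + Complex.I • (C + C')))
    (hM' : M' = (2 : ℂ)⁻¹ • (B + D + Complex.I • (C - C')))
    (hN' : N' = (2 : ℂ)⁻¹ • (B - D - Complex.I • (C + C'))) :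
    (fromRows (1 + Y) (-Complex.I • (1 - Y)))ᴴ * fromBlocks B C C' D *
      fromRows (1 + Y) (-Complex.I • (1 - Y)) =
      (2 : ℂ) • (M + Yᴴ * N' + N * Y + Yᴴ * M' * Y) := by
  rw [conjTranspose_fromRows_mul_fromBlocks_mul, hM, hN, hM', hN']
  simp only [conjTranspose_add, conjTranspose_sub, conjTranspose_smul, conjTranspose_one,
    Matrix.add_mul, Matrix.mul_add, Matrix.sub_mul, Matrix.mul_sub, Matrix.smul_mul,
    Matrix.mul_smul, Matrix.one_mul, Matrix.mul_one, smul_add, smul_sub, smul_smul,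
    star_neg, Complex.star_def, Complex.conj_I, neg_neg, neg_mul, Complex.I_mul_I]
  module

lemma gram_one_add_one_sub {n : ℕ} (Y : Matrix (Fin n) (Fin n) ℂ) :
    (fromRows (1 + Y) (-Complex.I • (1 - Y)))ᴴ * fromRows (1 + Y) (-Complex.I • (1 - Y)) =
      (2 : ℂ) • (1 + Yᴴ * Y) := by
  rw [conjTranspose_fromRows_eq_fromCols_conjTranspose, fromCols_mul_fromRows]
  simp only [conjTranspose_add, conjTranspose_sub, conjTranspose_smul, conjTranspose_one,
    Matrix.add_mul, Matrix.mul_add, Matrix.sub_mul, Matrix.mul_sub, Matrix.smul_mul,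
    Matrix.mul_smul, Matrix.one_mul, Matrix.mul_one, smul_add, smul_sub, smul_smul,
    star_neg, Complex.star_def, Complex.conj_I, neg_neg, neg_mul, Complex.I_mul_I]
  module

/-- The realification of a diagonalization of a real matrix. -/
lemma map_ofReal_eq_of_diagonalization {ι : Type*} [Fintype ι] [DecidableEq ι]
    {A P : Matrix ι ι ℝ} {d : ι → ℝ} (h : A = P * diagonal d * Pᴴ) :
    A.map Complex.ofReal = P.map Complex.ofReal * diagonal (fun i => (d i : ℂ)) *
      (P.map Complex.ofReal)ᴴ := by
  have hd : diagonal (fun i => (d i : ℂ)) = (diagonal d).map Complex.ofReal := by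
    rw [diagonal_map Complex.ofReal_zero]
  have hP : (P.map Complex.ofReal)ᴴ = Pᴴ.map Complex.ofReal := by
    ext i j; simp
  rw [hd, hP, h]
  change Matrix.map _ (Complex.ofRealHom) = Matrix.map _ (Complex.ofRealHom) *
    Matrix.map _ (Complex.ofRealHom) * Matrix.map _ (Complex.ofRealHom)
  rw [Matrix.map_mul, Matrix.map_mul]

lemma exists_sorted_diagonalization_map_ofReal {m : ℕ} {A : Matrix (Fin m) (Fin m) ℝ}
    (hA : A.IsHermitian) : ∃ P : Matrix (Fin m) (Fin m) ℂ, P * Pᴴ = 1 ∧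
      A.map Complex.ofReal = P * diagonal (fun i => (sortedEigs hA i : ℂ)) * Pᴴ := by
  obtain ⟨P, hP, -, hAP⟩ := exists_sorted_diagonalization hA
  refine ⟨P.map Complex.ofReal, ?_, map_ofReal_eq_of_diagonalization hAP⟩
  have h : (1 : Matrix (Fin m) (Fin m) ℝ) = P * diagonal (fun _ => 1) * Pᴴ := by
    rw [diagonal_one, Matrix.mul_one, hP]
  have := map_ofReal_eq_of_diagonalization h
  rw [Matrix.map_one _ Complex.ofReal_zero Complex.ofReal_one] at this
  simpa only [Complex.ofReal_one, diagonal_one, Matrix.mul_one] using this.symm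

lemma sortedEigs_pos {m : ℕ} {𝕜 : Type*} [RCLike 𝕜] {A : Matrix (Fin m) (Fin m) 𝕜}
    (hA : A.PosDef) (i : Fin m) : 0 < sortedEigs hA.1 i :=
  hA.eigenvalues_pos _

lemma posDef_map_ofReal {m : ℕ} {A : Matrix (Fin m) (Fin m) ℝ}
    (hA : A.PosDef) : (A.map Complex.ofReal).PosDef := by
  obtain ⟨P, hP, hAP⟩ := exists_sorted_diagonalization_map_ofReal hA.1
  rw [hAP, ← star_eq_conjTranspose,
    (IsUnit.of_mul_eq_one _ hP).posDef_star_right_conjugate_iff, posDef_diagonal_iff]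
  exact fun i => by exact_mod_cast sortedEigs_pos hA i

theorem stmt_19 (n : ℕ) (B C D : Matrix (Fin n) (Fin n) ℝ)
    (hB : B.IsSymm) (hD : D.IsSymm)
    (A : Matrix (Fin (n + n)) (Fin (n + n)) ℝ)
    (hAdef : A = (Matrix.fromBlocks B C Cᵀ D).submatrix finSumFinEquiv.symm finSumFinEquiv.symm)
    (hA : A.PosDef)
    (M N : Matrix (Fin n) (Fin n) ℂ)
    (hM : M = ((2 : ℂ)⁻¹) •
      (B.map Complex.ofReal + D.map Complex.ofReal -
        Complex.I • (C.map Complex.ofReal - Cᵀ.map Complex.ofReal)))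
    (hN : N = ((2 : ℂ)⁻¹) •
      (B.map Complex.ofReal - D.map Complex.ofReal +
        Complex.I • (C.map Complex.ofReal + Cᵀ.map Complex.ofReal))) :
    ∃ hS : (M - N * (M.map (starRingEnd ℂ))⁻¹ * N.map (starRingEnd ℂ)).PosDef,
      ∀ k : Fin n,
        sortedEigs hA.1 (Fin.castAdd n k) ≤ sortedEigs hS.1 k ∧
        sortedEigs hS.1 k ≤ sortedEigs hA.1 (Fin.natAdd n k) := by
  set M' := M.map (starRingEnd ℂ) with hM'def
  set N' := N.map (starRingEnd ℂ) with hN'def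
  have hM' : M' = ((2 : ℂ)⁻¹) • (B.map Complex.ofReal + D.map Complex.ofReal +
      Complex.I • (C.map Complex.ofReal - Cᵀ.map Complex.ofReal)) := by
    rw [hM'def, hM]; ext i j; simp [sub_eq_add_neg, Complex.conj_ofNat]; ring
  have hN' : N' = ((2 : ℂ)⁻¹) • (B.map Complex.ofReal - D.map Complex.ofReal -
      Complex.I • (C.map Complex.ofReal + Cᵀ.map Complex.ofReal)) := by
    rw [hN'def, hN]; ext i j; simp [sub_eq_add_neg, Complex.conj_ofNat]; ring
  have hNN' : N'ᴴ = N := by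
    rw [hN', hN]; ext i j
    simp [sub_eq_add_neg, hB.apply, hD.apply]
    ring
  set e := (finSumFinEquiv (m := n) (n := n)).symm
  let F (Y : Matrix (Fin n) (Fin n) ℂ) : Matrix (Fin (n + n)) (Fin n) ℂ :=
    (fromRows (1 + Y) (-Complex.I • (1 - Y))).submatrix e id
  let G := A.map Complex.ofReal
  have hG : G = (fromBlocks (B.map Complex.ofReal) (C.map Complex.ofReal)
      (Cᵀ.map Complex.ofReal) (D.map Complex.ofReal)).submatrix e e := by
    rw [← fromBlocks_map, submatrix_map, ← hAdef]
  have hFG (Y) : (F Y)ᴴ * G * F Y = (2 : ℂ) • (M + Yᴴ * N' + N * Y + Yᴴ * M' * Y) := by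
    rw [← congruence_one_add_one_sub _ _ _ _ M N M' N' Y hM hN hM' hN', hG]
    simp only [F, conjTranspose_submatrix, submatrix_mul_equiv, submatrix_id_id]
  have hFF (Y) : (F Y)ᴴ * F Y = (2 : ℂ) • (1 + Yᴴ * Y) := by
    rw [← gram_one_add_one_sub]
    simp only [F, conjTranspose_submatrix, submatrix_mul_equiv, submatrix_id_id]
  have hGpos : G.PosDef := posDef_map_ofReal hA
  have hFinj (Y) : Function.Injective (F Y).mulVec := by
    have hpd : ((F Y)ᴴ * F Y).PosDef := by
      rw [hFF]
      exact (PosDef.one.add_posSemidef (posSemidef_conjTranspose_mul_self Y)).smul (by norm_num)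
    intro x y hxy
    refine mulVec_injective_of_isUnit hpd.isUnit ?_
    simp only [← mulVec_mulVec]
    rw [hxy]
  have hquad (Y) : (M + Yᴴ * N' + N * Y + Yᴴ * M' * Y).PosDef := by
    have := hGpos.conjTranspose_mul_mul_same (hFinj Y)
    rw [hFG] at this
    have h2 : (0 : ℂ) < 2⁻¹ := by positivity
    simpa only [inv_smul_smul₀ (two_ne_zero (α := ℂ))] using this.smul h2
  have hMpos : M.PosDef := by simpa using hquad 0
  have hM'pos : M'.PosDef := by
    have : M' = Mᵀ := by
      rw [← hMpos.1.eq]; ext i j; simp [hM'def]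
    rw [this]; exact hMpos.transpose
  have hdet : IsUnit M'.det := (isUnit_iff_isUnit_det _).1 hM'pos.isUnit
  let Y := -(M'⁻¹ * N')
  have hYS : M + Yᴴ * N' + N * Y + Yᴴ * M' * Y = M - N * M'⁻¹ * N' := by
    have : M' * Y = -N' := by simp [Y, mul_nonsing_inv_cancel_left _ _ hdet]
    rw [Matrix.mul_assoc Yᴴ, this]
    simp only [Y, Matrix.mul_neg, Matrix.mul_assoc]
    abel
  have hS : (M - N * M'⁻¹ * N').PosDef := hYS ▸ hquad Y
  have hle : (N * M'⁻¹ * N').PosSemidef := by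
    rw [← hNN']
    exact hM'pos.inv.posSemidef.conjTranspose_mul_mul_same N'
  refine ⟨hS, fun k => ?_⟩
  obtain ⟨P, hP, hGP⟩ := exists_sorted_diagonalization_map_ofReal hA.1
  obtain ⟨Q, -, hQ, hSQ⟩ := exists_sorted_diagonalization hS.1
  have hSform (z) : (star z ⬝ᵥ (M - N * M'⁻¹ * N') *ᵥ z).re =
      ∑ i, sortedEigs hS.1 i * Complex.normSq ((Qᴴ *ᵥ z) i) := re_form_eq_sum hSQ z
  have hGform (z Y) : ∑ j, sortedEigs hA.1 j * Complex.normSq ((Pᴴ *ᵥ (F Y *ᵥ z)) j) =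
      2 * (star z ⬝ᵥ (M + Yᴴ * N' + N * Y + Yᴴ * M' * Y) *ᵥ z).re := by
    rw [← re_form_eq_sum hGP, mulVec_mulVec, star_mulVec_dotProduct, ← Matrix.mul_assoc, hFG,
      smul_mulVec, dotProduct_smul]
    simp
  have hFnorm (z Y) : ∑ j, Complex.normSq ((F Y *ᵥ z) j) =
      2 * (∑ i, Complex.normSq (z i) + ∑ i, Complex.normSq ((Y *ᵥ z) i)) := by
    rw [← re_star_dotProduct_self, star_mulVec_dotProduct, hFF, ← re_star_dotProduct_self,
      ← re_star_dotProduct_self, star_mulVec_dotProduct, smul_mulVec, dotProduct_smul,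
      add_mulVec, one_mulVec, dotProduct_add]
    simp
  constructor
  · refine le_of_diagonal_forms hP hQ (F Y) (sortedEigs hA.1) (sortedEigs hS.1)
      (Finset.Iic k) (Finset.Iio (Fin.castAdd n k)) (by simp)
      (fun i hi => sortedEigs_mono _ (Finset.mem_Iic.1 hi))
      (fun j hj => sortedEigs_mono _ (by simpa using hj)) (fun z => ?_) (fun z => ?_)
    · rw [hGform, hYS, hSform]
    · rw [hFnorm]
      have h0 : 0 ≤ sortedEigs hA.1 (Fin.castAdd n k) := (sortedEigs_pos hA _).le
      have h1 : 0 ≤ ∑ i, Complex.normSq ((Y *ᵥ z) i) :=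
        Finset.sum_nonneg fun i _ => Complex.normSq_nonneg _
      exact mul_le_mul_of_nonneg_left (by linarith) h0
  · refine neg_le_neg_iff.1 <| le_of_diagonal_forms hP hQ (F 0) (fun j => -sortedEigs hA.1 j)
      (fun i => -sortedEigs hS.1 i) (Finset.Ici k) (Finset.Ioi (Fin.natAdd n k))
      (by simp; omega)
      (fun i hi => neg_le_neg (sortedEigs_mono _ (Finset.mem_Ici.1 hi)))
      (fun j hj => neg_le_neg (sortedEigs_mono _ (by simpa using hj))) (fun z => ?_) (fun z => ?_)
    · simp only [neg_mul, Finset.sum_neg_distrib]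
      rw [hGform, ← hSform]
      have := hle.re_dotProduct_nonneg z
      simp only [sub_mulVec, dotProduct_sub, Complex.sub_re]
      simp at this ⊢
      linarith
    · rw [hFnorm]; simp
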